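/- k-th Golden binomial expansion: for every integer k ≥ 1, every natural number n, and all real x, y: ∏_{j=0}^{n−1} (x + φ^{k(n−1−j)} φ'^{kj} y) = ∑_{m=0}^n [n m]_k · (−1)^{k·m(m−1)/2} · x^{n−m} · y^m. -/

import Mathlib

noncomputable def gphi : ℝ := (1 + Real.sqrt 5) / 2
noncomputable def gphi' : ℝ := (1 - Real.sqrt 5) / 2

/-- The Fibonacci divisor factorial F_n^{(k)}! = ∏_{i=1}^n F_i^{(k)},
    where F_i^{(k)} = F_{ik}/F_k (empty product 1 for n = 0). -/
noncomputable def fibDivFact (k n : ℕ) : ℝ :=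
  ∏ i ∈ Finset.range n, ((Nat.fib ((i + 1) * k) : ℝ) / (Nat.fib k : ℝ))

/-- The k-th Fibonomial coefficient [n m]_k = F_n^{(k)}! / (F_m^{(k)}! F_{n−m}^{(k)}!). -/
noncomputable def fibonomial (k n m : ℕ) : ℝ :=
  fibDivFact k n / (fibDivFact k m * fibDivFact k (n - m))

lemma gb_fib (k i : ℕ) : (Nat.fib (i * k) : ℝ) = ((gphi ^ k) ^ i - (gphi' ^ k) ^ i) / Real.sqrt 5 := by
  rw [Real.coe_fib_eq, ← pow_mul, ← pow_mul, mul_comm k i]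
  rfl

lemma gb_mul (k : ℕ) : gphi ^ k * gphi' ^ k = (-1) ^ k := by
  rw [← mul_pow]
  congr 1
  exact Real.goldenRatio_mul_goldenConj

lemma gb_succ (k n : ℕ) : fibDivFact k (n + 1) =
    fibDivFact k n * ((Nat.fib ((n + 1) * k) : ℝ) / (Nat.fib k : ℝ)) := by
  unfold fibDivFact
  rw [Finset.prod_range_succ]

lemma gb_ne (k : ℕ) (hk : 1 ≤ k) (n : ℕ) : (Nat.fib ((n + 1) * k) : ℝ) / (Nat.fib k : ℝ) ≠ 0 := by
  have h1 : 0 < Nat.fib k := Nat.fib_pos.2 hk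
  have h2 : 0 < Nat.fib ((n + 1) * k) := Nat.fib_pos.2 (by positivity)
  positivity

lemma gb_fact_ne (k : ℕ) (hk : 1 ≤ k) (n : ℕ) : fibDivFact k n ≠ 0 :=
  Finset.prod_ne_zero_iff.2 fun i _ => gb_ne k hk i

lemma gb_pascal (k : ℕ) (hk : 1 ≤ k) (m p : ℕ) :
    fibonomial k (m + 1 + p + 1) (m + 1) =
      (gphi ^ k) ^ (m + 1) * fibonomial k (m + 1 + p) (m + 1)
        + (gphi' ^ k) ^ (p + 1) * fibonomial k (m + 1 + p) m := by
  have e1 : m + 1 + p + 1 - (m + 1) = p + 1 := by omega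
  have e2 : m + 1 + p - (m + 1) = p := by omega
  have e3 : m + 1 + p - m = p + 1 := by omega
  unfold fibonomial
  rw [e1, e2, e3, gb_succ k (m + 1 + p), gb_succ k m, gb_succ k p]
  have key : (Nat.fib ((m + 1 + p + 1) * k) : ℝ) / (Nat.fib k : ℝ) =
      (gphi ^ k) ^ (m + 1) * ((Nat.fib ((p + 1) * k) : ℝ) / (Nat.fib k : ℝ))
      + (gphi' ^ k) ^ (p + 1) * ((Nat.fib ((m + 1) * k) : ℝ) / (Nat.fib k : ℝ)) := by
    rw [gb_fib k (m + 1 + p + 1), gb_fib k (p + 1), gb_fib k (m + 1)]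
    ring
  rw [key]
  have h1 := gb_ne k hk m
  have h2 := gb_ne k hk p
  have h3 := gb_fact_ne k hk m
  have h4 := gb_fact_ne k hk p
  generalize (Nat.fib ((m + 1) * k) : ℝ) / (Nat.fib k : ℝ) = u at *
  generalize (Nat.fib ((p + 1) * k) : ℝ) / (Nat.fib k : ℝ) = v at *
  field_simp

lemma gb_zero (k : ℕ) (hk : 1 ≤ k) (n : ℕ) : fibonomial k n 0 = 1 := by
  have := gb_fact_ne k hk n
  have h0 : fibDivFact k 0 = 1 := by simp [fibDivFact]
  simp [fibonomial, h0, this]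

lemma gb_self (k : ℕ) (hk : 1 ≤ k) (n : ℕ) : fibonomial k n n = 1 := by
  have := gb_fact_ne k hk n
  have h0 : fibDivFact k 0 = 1 := by simp [fibDivFact]
  simp [fibonomial, h0, this]

lemma gb_sign (k m : ℕ) : (-1 : ℝ) ^ (k * ((m + 1) * (m + 1 - 1) / 2)) =
    (-1 : ℝ) ^ (k * (m * (m - 1) / 2)) * ((gphi ^ k) ^ m * (gphi' ^ k) ^ m) := by
  rw [← mul_pow, gb_mul, ← pow_mul, ← pow_add, ← mul_add]
  congr 2
  have := Finset.sum_range_succ (fun i => i) m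
  rwa [Finset.sum_range_id, Finset.sum_range_id] at this

/-- k-th Golden binomial expansion: for k ≥ 1, n : ℕ, x y : ℝ,
    ∏_{j=0}^{n−1} (x + φ^{k(n−1−j)} φ'^{kj} y)
      = ∑_{m=0}^n [n m]_k (−1)^{k·m(m−1)/2} x^{n−m} y^m. -/
theorem golden_binomial_expansion (k : ℕ) (hk : 1 ≤ k) (n : ℕ) (x y : ℝ) :
    (∏ j ∈ Finset.range n, (x + gphi ^ (k * (n - 1 - j)) * gphi' ^ (k * j) * y)) =
      ∑ m ∈ Finset.range (n + 1),
        fibonomial k n m * (-1 : ℝ) ^ (k * (m * (m - 1) / 2)) * x ^ (n - m) * y ^ m := by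
  induction n generalizing y with
  | zero => simp [gb_zero k hk]
  | succ n ih =>
    rw [Finset.prod_range_succ]
    have h1 : ∏ j ∈ Finset.range n, (x + gphi ^ (k * (n + 1 - 1 - j)) * gphi' ^ (k * j) * y) =
        ∏ j ∈ Finset.range n, (x + gphi ^ (k * (n - 1 - j)) * gphi' ^ (k * j) * (gphi ^ k * y)) := by
      refine Finset.prod_congr rfl fun j hj => ?_
      have hj := Finset.mem_range.1 hj
      have : n + 1 - 1 - j = (n - 1 - j) + 1 := by omega
      rw [this, mul_add, pow_add]
      ring
    rw [h1, ih]
    have h2 : gphi ^ (k * (n + 1 - 1 - n)) * gphi' ^ (k * n) = (gphi' ^ k) ^ n := by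
      simp [pow_mul]
    rw [h2, mul_add]
    nth_rewrite 1 [Finset.sum_range_succ']
    nth_rewrite 1 [Finset.sum_range_succ]
    rw [Finset.sum_range_succ' _ (n + 1), Finset.sum_range_succ _ n]
    have h3 : ∀ m ∈ Finset.range n,
        fibonomial k (n + 1) (m + 1) * (-1 : ℝ) ^ (k * ((m + 1) * (m + 1 - 1) / 2))
          * x ^ (n + 1 - (m + 1)) * y ^ (m + 1) =
        fibonomial k n (m + 1) * (-1 : ℝ) ^ (k * ((m + 1) * (m + 1 - 1) / 2))
          * x ^ (n - (m + 1)) * (gphi ^ k * y) ^ (m + 1) * x +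
        fibonomial k n m * (-1 : ℝ) ^ (k * (m * (m - 1) / 2))
          * x ^ (n - m) * (gphi ^ k * y) ^ m * ((gphi' ^ k) ^ n * y) := by
      intro m hm
      obtain ⟨p, rfl⟩ := Nat.exists_eq_add_of_le (Nat.succ_le_of_lt (Finset.mem_range.1 hm))
      have e1 : m.succ + p + 1 - (m + 1) = p + 1 := by omega
      have e2 : m.succ + p - (m + 1) = p := by omega
      have e3 : m.succ + p - m = p + 1 := by omega
      rw [e1, e2, e3, gb_sign]
      simp only [Nat.succ_eq_add_one]
      rw [gb_pascal k hk]
      generalize gphi ^ k = a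
      generalize gphi' ^ k = b
      ring
    rw [Finset.sum_congr rfl h3, Finset.sum_add_distrib, ← Finset.sum_mul, ← Finset.sum_mul,
      gb_sign k n]
    simp only [gb_zero k hk, gb_self k hk, Nat.sub_self, Nat.sub_zero]
    generalize gphi ^ k = a
    generalize gphi' ^ k = b
    simp only [zero_mul, Nat.zero_div, mul_zero, pow_zero]
    ring
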